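/- arXiv:2409.12021 — 5 statements merged into one kernel-verified Lean document; each statement's English description precedes it below -/
import Mathlib

section
/- With this setup, the number of indices j ∈ Fin n with a(j) < m is at least 3·⌊⌈n/5⌉/2⌋ (in particular, at least (3n−15)/10 elements of the input are strictly smaller than the median of medians m). -/
/-- If all blocks indexed by `I` have at least three elements, except possibly one block `l`
with at least one, and a further block `k` makes up for it with two elements,
then together the blocks below `g` have at least `3 * #I` elements. -/
theorem three_mul_card_le_sum_range {g l k : ℕ} {c : ℕ → ℕ} {I : Finset ℕ}
    (hI : I ⊆ Finset.range g) (hk : k < g) (hkI : k ∉ I)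
    (hc : ∀ i ∈ I, i ≠ l → 3 ≤ c i) (hl : l ∈ I → 1 ≤ c l) (hck : k ≠ l → 2 ≤ c k) :
    3 * I.card ≤ ∑ i ∈ Finset.range g, c i := by
  by_cases h : l ∈ I
  · have hkl : k ≠ l := fun e => hkI (e ▸ h)
    have h1 : ∑ i ∈ insert k I, c i ≤ ∑ i ∈ Finset.range g, c i :=
      Finset.sum_le_sum_of_subset (Finset.insert_subset (Finset.mem_range.2 hk) hI)
    rw [Finset.sum_insert hkI, ← Finset.add_sum_erase I c h] at h1
    have h2 : (I.erase l).card • 3 ≤ ∑ i ∈ I.erase l, c i :=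
      Finset.card_nsmul_le_sum _ _ _ fun i hi =>
        hc i (Finset.mem_of_mem_erase hi) (Finset.ne_of_mem_erase hi)
    have h3 := Finset.card_erase_add_one h
    have h4 := hl h
    have h5 := hck hkl
    simp only [smul_eq_mul] at h2
    omega
  · have h1 : ∑ i ∈ I, c i ≤ ∑ i ∈ Finset.range g, c i := Finset.sum_le_sum_of_subset hI
    have h2 : I.card • 3 ≤ ∑ i ∈ I, c i :=
      Finset.card_nsmul_le_sum _ _ _ fun i hi => hc i hi fun e => h (e ▸ hi)
    simp only [smul_eq_mul] at h2
    omega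

theorem card_filter_lt_add_one_le {α : Type*} [LinearOrder α] {s : Finset α} {x m : α}
    (hx : x ∈ s) (hxm : x < m) :
    (s.filter (fun y => y < x)).card + 1 ≤ (s.filter (fun y => y < m)).card := by
  rw [← Finset.card_insert_of_notMem (a := x) (by simp)]
  refine Finset.card_le_card fun y hy => ?_
  rcases Finset.mem_insert.1 hy with rfl | hy
  · simp [hx, hxm]
  · rw [Finset.mem_filter] at hy ⊢
    exact ⟨hy.1, hy.2.trans hxm⟩

theorem card_filter_fin_interval {n p q : ℕ} (hq : q ≤ n) :
    (Finset.univ.filter (fun j : Fin n => p ≤ (j : ℕ) ∧ (j : ℕ) < q)).card = q - p := by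
  rw [← Nat.card_Ico, ← Finset.card_map Fin.valEmbedding]
  congr 1
  ext x
  simp only [Finset.mem_map, Finset.mem_filter, Finset.mem_univ, true_and, Fin.valEmbedding_apply,
    Finset.mem_Ico]
  exact ⟨fun ⟨j, hj, e⟩ => e ▸ hj, fun hx => ⟨⟨x, by omega⟩, hx, rfl⟩⟩

/-- Median-of-medians selection: at least `3 * ⌊⌈n/5⌉/2⌋` input elements are
strictly smaller than the median of medians `m`. -/
theorem kSelection_lower_bound_lt {α : Type*} [LinearOrder α]
    (n : ℕ) (hn : 7 ≤ n)
    (a : Fin n → α) (ha : Function.Injective a)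
    (g : ℕ) (hg : g = (n + 4) / 5)
    (G : ℕ → Finset α)
    (hG : ∀ i < g, G i = (Finset.univ.filter
      (fun j : Fin n => 5 * i ≤ (j : ℕ) ∧ (j : ℕ) < min (5 * (i + 1)) n)).image a)
    (med : ℕ → α)
    (hmed_mem : ∀ i < g, med i ∈ G i)
    (hmed : ∀ i < g, ((G i).filter (fun x => x < med i)).card = (G i).card / 2)
    (M : Finset α) (hM : M = (Finset.range g).image med)
    (hMcard : M.card = g)
    (m : α) (hm : m ∈ M)
    (hmm : (M.filter (fun x => x < m)).card = g / 2) :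
    3 * (g / 2) ≤ (Finset.univ.filter (fun j : Fin n => a j < m)).card := by
  subst hM
  obtain ⟨k, hk, rfl⟩ := Finset.mem_image.1 hm
  rw [Finset.mem_range] at hk
  have hinj : Set.InjOn med (Finset.range g) :=
    Finset.card_image_iff.1 (hMcard.trans (Finset.card_range g).symm)
  have hI : ((Finset.range g).filter (fun i => med i < med k)).card = g / 2 := by
    rw [← hmm, Finset.filter_image,
      Finset.card_image_of_injOn (hinj.mono (Finset.coe_subset.2 (Finset.filter_subset _ _)))]
  have hcard : ∀ i < g, (G i).card = min (5 * (i + 1)) n - 5 * i := fun i hi => by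
    rw [hG i hi, Finset.card_image_of_injective _ ha, card_filter_fin_interval (min_le_right _ _)]
  have hsum : (Finset.univ.filter (fun j : Fin n => a j < med k)).card =
      ∑ i ∈ Finset.range g, ((G i).filter (fun x => x < med k)).card := by
    rw [Finset.card_eq_sum_card_fiberwise (f := fun j : Fin n => (j : ℕ) / 5)
      (t := Finset.range g) fun j _ => by
        have := j.isLt
        simp only [Finset.coe_range, Set.mem_Iio]
        omega]
    refine Finset.sum_congr rfl fun i hi => ?_
    rw [hG i (Finset.mem_range.1 hi), Finset.filter_image,
      Finset.card_image_of_injective _ ha, Finset.filter_filter, Finset.filter_filter]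
    congr 1
    ext j
    have := j.isLt
    simp only [Finset.mem_filter, Finset.mem_univ, true_and, and_comm (a := a j < med k)]
    refine and_congr_left fun _ => ?_
    omega
  rw [hsum, ← hI]
  have hlt : ∀ i < g, med i < med k →
      (G i).card / 2 + 1 ≤ ((G i).filter (fun x => x < med k)).card := fun i hi h =>
    hmed i hi ▸ card_filter_lt_add_one_le (hmed_mem i hi) h
  refine three_mul_card_le_sum_range (l := g - 1) (k := k) (Finset.filter_subset _ _) hk
    (by simp) (fun i hi hil => ?_) (fun hl => ?_) fun hkl => ?_
  · rw [Finset.mem_filter, Finset.mem_range] at hi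
    have h1 := hlt i hi.1 hi.2
    have h2 := hcard i hi.1
    omega
  · rw [Finset.mem_filter, Finset.mem_range] at hl
    have h1 := hlt _ hl.1 hl.2
    omega
  · have h1 := hmed k hk
    have h2 := hcard k hk
    omega
end

section
/- With this setup, the number of indices j ∈ Fin n with a(j) ≥ m is at least 3·⌈n/10⌉ − 2 (in particular, at least (3n−20)/10 elements of the input are greater than or equal to the median of medians m). -/
/-- The indices of `Fin n` lying in `[l, u)` number `u - l` when `u ≤ n`. -/
theorem Fin.card_filter_le_val_lt {n l u : ℕ} (hu : u ≤ n) :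
    (Finset.univ.filter (fun j : Fin n => l ≤ (j : ℕ) ∧ (j : ℕ) < u)).card = u - l := by
  rw [← Nat.card_Ico, ← Finset.card_map Fin.valEmbedding]
  congr 1
  ext x
  simp only [Finset.mem_map, Finset.mem_filter, Finset.mem_univ, true_and,
    Fin.valEmbedding_apply, Finset.mem_Ico]
  constructor
  · rintro ⟨j, hj, rfl⟩
    exact hj
  · intro hx
    exact ⟨⟨x, by omega⟩, hx, rfl⟩

/-- Removing the elements below `c` from an image leaves at most as many elements as there are
indices with value at least `c`. -/
theorem Finset.card_image_sub_card_filter_lt_le {ι α : Type*} [LinearOrder α]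
    (s : Finset ι) (f : ι → α) (c : α) :
    (s.image f).card - ((s.image f).filter (fun x => x < c)).card
      ≤ (s.filter (fun j => c ≤ f j)).card := by
  have hsplit := Finset.card_filter_add_card_filter_not (s := s.image f) (fun x => x < c)
  have hle : ((s.image f).filter (fun x => ¬ x < c)).card
      ≤ (s.filter (fun j => c ≤ f j)).card := by
    rw [Finset.filter_image]
    simpa only [not_lt] using Finset.card_image_le
  omega

/-- If every element of `S` other than `k` has weight at least `3`, and `k` has weight at
least `1`, then `S` has total weight at least `3 * #S - 2`. -/
theorem Finset.three_mul_card_sub_two_le_sum {ι : Type*} [DecidableEq ι] (S : Finset ι)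
    (k : ι) (w : ι → ℕ) (hw : ∀ i ∈ S, 3 ≤ w i + if i = k then 2 else 0) :
    3 * S.card - 2 ≤ ∑ i ∈ S, w i := by
  have hsum := Finset.card_nsmul_le_sum S _ 3 hw
  rw [Finset.sum_add_distrib, Finset.sum_ite_eq', smul_eq_mul] at hsum
  split_ifs at hsum <;> omega


/-- Median-of-medians selection: at least `3 * ⌈n/10⌉ - 2` input elements are
greater than or equal to the median of medians `m`. -/
theorem kSelection_lower_bound_ge {α : Type*} [LinearOrder α]
    (n : ℕ) (hn : 7 ≤ n)
    (a : Fin n → α) (ha : Function.Injective a)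
    (g : ℕ) (hg : g = (n + 4) / 5)
    (G : ℕ → Finset α)
    (hG : ∀ i < g, G i = (Finset.univ.filter
      (fun j : Fin n => 5 * i ≤ (j : ℕ) ∧ (j : ℕ) < min (5 * (i + 1)) n)).image a)
    (med : ℕ → α)
    (hmed_mem : ∀ i < g, med i ∈ G i)
    (hmed : ∀ i < g, ((G i).filter (fun x => x < med i)).card = (G i).card / 2)
    (M : Finset α) (hM : M = (Finset.range g).image med)
    (hMcard : M.card = g)
    (m : α) (hm : m ∈ M)
    (hmm : (M.filter (fun x => x < m)).card = g / 2) :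
    3 * ((n + 9) / 10) - 2 ≤ (Finset.univ.filter (fun j : Fin n => m ≤ a j)).card := by
  set S := (Finset.range g).filter (fun i => m ≤ med i) with hS
  have hScard : (n + 9) / 10 ≤ S.card := by
    have h := Finset.card_image_sub_card_filter_lt_le (Finset.range g) med m
    rw [← hM, hMcard, hmm, ← hS] at h
    omega
  have hfiber : ∀ i ∈ S, 3 ≤ ((Finset.univ.filter (fun j : Fin n => m ≤ a j)).filter
      (fun j : Fin n => (j : ℕ) / 5 = i)).card + if i = g - 1 then 2 else 0 := by
    intro i hi
    obtain ⟨hig, him⟩ := Finset.mem_filter.1 hi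
    rw [Finset.mem_range] at hig
    have hcard : (G i).card = min (5 * (i + 1)) n - 5 * i := by
      rw [hG i hig, Finset.card_image_of_injective _ ha,
        Fin.card_filter_le_val_lt (min_le_right _ _)]
    have hlow := Finset.card_image_sub_card_filter_lt_le (Finset.univ.filter
      (fun j : Fin n => 5 * i ≤ (j : ℕ) ∧ (j : ℕ) < min (5 * (i + 1)) n)) a (med i)
    rw [← hG i hig, hmed i hig, hcard] at hlow
    refine le_trans ?_ (Nat.add_le_add_right (hlow.trans (Finset.card_le_card ?_)) _)
    · split_ifs <;> omega
    · intro j hj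
      simp only [Finset.mem_filter, Finset.mem_univ, true_and] at hj ⊢
      exact ⟨him.trans hj.2, by omega⟩
  calc 3 * ((n + 9) / 10) - 2 ≤ 3 * S.card - 2 := by omega
    _ ≤ _ := Finset.three_mul_card_sub_two_le_sum S (g - 1) _ hfiber
    _ ≤ _ := by
      rw [Finset.sum_card_fiberwise_eq_card_filter]
      exact Finset.card_filter_le _ _
end

section
/- If the total number of true values of f and g together is at most n (i.e., #f + #g ≤ n), then for every index i ∈ Fin n the value f(i) && g(n−1−i) is false; that is, the consolidated block f' is pure (consists only of false values). -/
/-- A monotone Boolean function that is `true` at `i` is `true` on all of `[i, n)`. -/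
theorem sub_le_card_filter_of_monotone {n : ℕ} {f : Fin n → Bool} (hf : Monotone f)
    {i : Fin n} (hi : f i = true) :
    n - i ≤ (Finset.univ.filter (fun j : Fin n => f j = true)).card := by
  rw [← Fin.card_Ici]
  refine Finset.card_le_card fun j hj => ?_
  simpa using hf (Finset.mem_Ici.mp hj) hi

/-- PurifyHalf consolidation: if the total number of `true` values of the two
partitioned blocks `f` and `g` is at most `n`, then the consolidated block
`f' : i ↦ f i && g (n−1−i)` is pure (consists only of `false` values). -/
theorem purifyHalf_pure_false (n : ℕ) (hn : 1 ≤ n) (f g : Fin n → Bool)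
    (hf : Monotone f) (hg : Monotone g)
    (h : (Finset.univ.filter (fun i : Fin n => f i = true)).card
        + (Finset.univ.filter (fun i : Fin n => g i = true)).card ≤ n) :
    ∀ i : Fin n, (f i && g i.rev) = false := by
  intro i
  by_contra hi
  obtain ⟨hfi, hgi⟩ : f i = true ∧ g i.rev = true := by simpa using hi
  have hcf := sub_le_card_filter_of_monotone hf hfi
  have hcg := sub_le_card_filter_of_monotone hg hgi
  rw [Fin.val_rev] at hcg
  omega
end

section
/- If the total number of true values of f and g together is at least n (i.e., #f + #g ≥ n), then for every index j ∈ Fin n the value f(n−1−j) || g(j) is true; that is, the consolidated block g' is pure (consists only of true values). -/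
/-- A monotone Boolean function that is `false` at `i` is `true` at most at the `n - 1 - i` indices above `i`. -/
theorem card_filter_true_le_of_monotone {n : ℕ} {f : Fin n → Bool} (hf : Monotone f)
    {i : Fin n} (hi : f i = false) :
    (Finset.univ.filter (fun k : Fin n => f k = true)).card ≤ n - 1 - i := by
  rw [← Fin.card_Ioi]
  refine Finset.card_le_card fun k hk => ?_
  rw [Finset.mem_filter] at hk
  rw [Finset.mem_Ioi]
  by_contra! hki
  have hle := hf hki
  rw [hk.2, hi] at hle
  exact absurd hle (by decide)

/-- PurifyHalf consolidation: if the total number of `true` values of the two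
partitioned blocks `f` and `g` is at least `n`, then the consolidated block
`g' : j ↦ f (n−1−j) || g j` is pure (consists only of `true` values). -/
theorem purifyHalf_pure_true (n : ℕ) (hn : 1 ≤ n) (f g : Fin n → Bool)
    (hf : Monotone f) (hg : Monotone g)
    (h : n ≤ (Finset.univ.filter (fun i : Fin n => f i = true)).card
        + (Finset.univ.filter (fun i : Fin n => g i = true)).card) :
    ∀ j : Fin n, (f j.rev || g j) = true := by
  intro j
  by_contra hj
  rw [Bool.not_eq_true, Bool.or_eq_false_iff] at hj
  have hf_card := card_filter_true_le_of_monotone hf hj.1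
  have hg_card := card_filter_true_le_of_monotone hg hj.2
  rw [Fin.val_rev] at hf_card
  omega
end

section
/- The set of indices j with f(n−1−j) || g(j) = false is order-convex in Fin n (i.e., if the value is false at j₁ and at j₃ with j₁ ≤ j₂ ≤ j₃, then it is false at j₂), and likewise the set of indices i with f(i) && g(n−1−i) = true is order-convex; hence both consolidated blocks f' and g' are bitonically partitioned (all equal values among the minority side are consecutive). -/
/-- PurifyHalf consolidation: the set of indices where `f' : j ↦ f (n−1−j) || g j`
is `false` is order-convex, and likewise the set of indices where
`i ↦ f i && g (n−1−i)` is `true` is order-convex; hence both consolidated blocks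
are bitonically partitioned. -/
theorem purifyHalf_bitonic (n : ℕ) (hn : 1 ≤ n) (f g : Fin n → Bool)
    (hf : Monotone f) (hg : Monotone g) :
    (∀ j₁ j₂ j₃ : Fin n, j₁ ≤ j₂ → j₂ ≤ j₃ →
        (f j₁.rev || g j₁) = false → (f j₃.rev || g j₃) = false →
        (f j₂.rev || g j₂) = false) ∧
      (∀ i₁ i₂ i₃ : Fin n, i₁ ≤ i₂ → i₂ ≤ i₃ →
        (f i₁ && g i₁.rev) = true → (f i₃ && g i₃.rev) = true →
        (f i₂ && g i₂.rev) = true) := by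
  refine ⟨fun j₁ j₂ j₃ h₁₂ h₂₃ h₁ h₃ => ?_, fun i₁ i₂ i₃ h₁₂ h₂₃ h₁ h₃ => ?_⟩
  · rw [Bool.or_eq_false_iff] at h₁ h₃ ⊢
    exact ⟨Bool.eq_false_of_le_false (h₁.1 ▸ hf (Fin.rev_le_rev.mpr h₁₂)),
      Bool.eq_false_of_le_false (h₃.2 ▸ hg h₂₃)⟩
  · rw [Bool.and_eq_true] at h₁ h₃ ⊢
    exact ⟨Bool.eq_true_of_true_le (h₁.1 ▸ hf h₁₂),
      Bool.eq_true_of_true_le (h₃.2 ▸ hg (Fin.rev_le_rev.mpr h₂₃))⟩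
end
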